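/- G is invertible, there exists a constant C_A > 0 such that ||A_j^n|| <= C_A for all n >= j >= 1, and (1/n) * sum_{j=1}^{n} || A_j^n - G^{-1} || converges to 0 as n tends to infinity. -/

import Mathlib

open Filter

/-- The operator norm of a real `d × d` matrix, acting on Euclidean space. -/
noncomputable def matOpNorm {d : ℕ} (M : Matrix (Fin d) (Fin d) ℝ) : ℝ :=
  ‖LinearMap.toContinuousLinearMap (Matrix.toEuclideanLin M)‖

section ContractingNorm

/-- Powers of an element whose spectrum lies in the open unit disc decay geometrically. -/
theorem exists_norm_pow_le_of_spectrum_lt_one {A : Type*} [NormedRing A] [NormedAlgebra ℂ A]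
    [CompleteSpace A] (a : A) (ha : ∀ z ∈ spectrum ℂ a, ‖z‖ < 1) :
    ∃ K ρ : ℝ, 0 < ρ ∧ ρ < 1 ∧ ∀ k : ℕ, ‖a ^ k‖ ≤ K * ρ ^ k := by
  rcases subsingleton_or_nontrivial A with hA | hA
  · refine ⟨0, 1 / 2, by norm_num, by norm_num, fun k => ?_⟩
    simp [Subsingleton.elim (a ^ k) 0]
  have h1 : spectralRadius ℂ a < ((1 : NNReal) : ENNReal) :=
    spectrum.spectralRadius_lt_of_forall_lt a fun z hz => by
      exact_mod_cast ha z hz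
  obtain ⟨ρ, hρ, hρ1⟩ := ENNReal.lt_iff_exists_nnreal_btwn.1 h1
  have hρ0 : (0 : ℝ) < ρ := by
    exact_mod_cast (zero_le.trans_lt hρ : (0 : ENNReal) < ρ)
  have hev : ∀ᶠ n : ℕ in atTop, ‖a ^ n‖ ≤ (ρ : ℝ) ^ n := by
    have hlim := spectrum.pow_nnnorm_pow_one_div_tendsto_nhds_spectralRadius a
    filter_upwards [hlim.eventually_lt_const hρ, eventually_gt_atTop 0] with n hn hn0
    have hn' : (0 : ℝ) < n := by exact_mod_cast hn0
    have := ENNReal.rpow_le_rpow hn.le hn'.le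
    rw [← ENNReal.rpow_mul, one_div_mul_cancel hn'.ne', ENNReal.rpow_one,
      ENNReal.rpow_natCast] at this
    exact_mod_cast this
  obtain ⟨m, hm⟩ := eventually_atTop.1 hev
  refine ⟨1 + ∑ k ∈ Finset.range m, ‖a ^ k‖ / (ρ : ℝ) ^ k, ρ, hρ0, by exact_mod_cast hρ1,
    fun k => ?_⟩
  have hnn : ∀ k ∈ Finset.range m, 0 ≤ ‖a ^ k‖ / (ρ : ℝ) ^ k := fun k _ => by positivity
  have hpow : (0 : ℝ) < (ρ : ℝ) ^ k := pow_pos hρ0 k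
  rcases le_or_gt m k with h | h
  · exact (hm k h).trans (le_mul_of_one_le_left hpow.le (by linarith [Finset.sum_nonneg hnn]))
  · rw [← div_le_iff₀ hpow]
    linarith [Finset.single_le_sum hnn (Finset.mem_range.2 h)]

variable {R : Type*} [NormedRing R] [NormedAlgebra ℝ R]

/-- If the powers of `1 - h • G` decay geometrically, there is an equivalent gauge `N` for which left
multiplication by `1 - s • G` is a contraction with factor `1 - c * s`, for all small `s`. -/
theorem exists_contracting_gauge (G : R) {h K ρ : ℝ} (hh : 0 < h) (hρ0 : 0 < ρ) (hρ1 : ρ < 1)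
    (hK : ∀ k : ℕ, ‖(1 - h • G) ^ k‖ ≤ K * ρ ^ k) :
    ∃ (N : R → ℝ) (c : ℝ), 0 < c ∧ (∀ x, ‖x‖ ≤ N x) ∧ (∀ x, N x ≤ K * ‖x‖) ∧
      (∀ x y, N (x + y) ≤ N x + N y) ∧ (∀ a x, 0 ≤ a → N (a • x) ≤ a * N x) ∧
      ∀ s x, 0 ≤ s → s ≤ h → N ((1 - s • G) * x) ≤ (1 - c * s) * N x := by
  set M : R := 1 - h • G with hM
  have hle : ∀ x k, ‖M ^ k * x‖ / ρ ^ k ≤ K * ‖x‖ := fun x k => by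
    rw [div_le_iff₀ (pow_pos hρ0 k)]
    calc ‖M ^ k * x‖ ≤ ‖M ^ k‖ * ‖x‖ := norm_mul_le _ _
      _ ≤ K * ρ ^ k * ‖x‖ := by gcongr; exact hK k
      _ = K * ‖x‖ * ρ ^ k := by ring
  have hbdd : ∀ x, BddAbove (Set.range fun k : ℕ => ‖M ^ k * x‖ / ρ ^ k) := fun x =>
    ⟨K * ‖x‖, by rintro _ ⟨k, rfl⟩; exact hle x k⟩
  let N : R → ℝ := fun x => ⨆ k : ℕ, ‖M ^ k * x‖ / ρ ^ k
  have hN : ∀ x (k : ℕ), ‖M ^ k * x‖ / ρ ^ k ≤ N x := fun x k => le_ciSup (hbdd x) k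
  have hadd : ∀ x y, N (x + y) ≤ N x + N y := fun x y => ciSup_le fun k => by
    refine le_trans ?_ (add_le_add (hN x k) (hN y k))
    rw [mul_add, ← add_div]
    gcongr
    exact norm_add_le _ _
  have hsmul : ∀ a x, 0 ≤ a → N (a • x) ≤ a * N x := fun a x ha => ciSup_le fun k => by
    rw [mul_smul_comm, norm_smul, Real.norm_of_nonneg ha, mul_div_assoc]
    gcongr
    exact hN x k
  have hmul : ∀ x, N (M * x) ≤ ρ * N x := fun x => ciSup_le fun k => by
    have := mul_le_mul_of_nonneg_left (hN x (k + 1)) hρ0.le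
    refine le_trans (le_of_eq ?_) this
    rw [← mul_assoc, ← pow_succ, pow_succ ρ]
    field_simp
  refine ⟨N, (1 - ρ) / h, div_pos (by linarith) hh, fun x => by simpa using hN x 0,
    fun x => ciSup_le (hle x), hadd, hsmul, fun s x hs hsh => ?_⟩
  have hsh' : s / h ≤ 1 := (div_le_one hh).2 hsh
  have hs' : 0 ≤ s / h := by positivity
  have hdecomp : (1 - s • G) * x = (1 - s / h) • x + (s / h) • (M * x) := by
    have : s • G = (s / h) • (h • G) := by rw [smul_smul, div_mul_cancel₀ _ hh.ne']
    rw [this, hM, sub_mul, sub_mul, one_mul, smul_mul_assoc, smul_sub, sub_smul, one_smul]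
    abel
  calc N ((1 - s • G) * x) ≤ N ((1 - s / h) • x) + N ((s / h) • (M * x)) := by
        rw [hdecomp]; exact hadd _ _
    _ ≤ (1 - s / h) * N x + (s / h) * (ρ * N x) := by
        refine add_le_add (hsmul _ _ (by linarith)) ((hsmul _ _ hs').trans ?_)
        gcongr
        exact hmul x
    _ = (1 - (1 - ρ) / h * s) * N x := by ring

end ContractingNorm

section StepSizes

variable {η : ℕ → ℝ}

theorem le_of_le_of_succ_le (hηmono : ∀ t, 1 ≤ t → η (t + 1) ≤ η t) {i j : ℕ} (hi : 1 ≤ i)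
    (hij : i ≤ j) : η j ≤ η i := by
  induction j, hij using Nat.le_induction with
  | base => exact le_rfl
  | succ j hj ih => exact (hηmono j (hi.trans hj)).trans ih

theorem le_two_mul_succ (hηpos : ∀ t, 1 ≤ t → 0 < η t)
    (htη_mono : ∀ t : ℕ, 1 ≤ t → (t : ℝ) * η t ≤ ((t : ℝ) + 1) * η (t + 1)) {t : ℕ}
    (ht : 1 ≤ t) : η t ≤ 2 * η (t + 1) := by
  have h1 : (1 : ℝ) ≤ t := by exact_mod_cast ht
  have h2 := hηpos (t + 1) (by omega)
  have : (t : ℝ) * η t ≤ t * (2 * η (t + 1)) := by nlinarith [htη_mono t ht]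
  exact le_of_mul_le_mul_left this (by linarith)

theorem tendsto_sub_div_succ_sq (hηpos : ∀ t, 1 ≤ t → 0 < η t)
    (hηmono : ∀ t, 1 ≤ t → η (t + 1) ≤ η t)
    (htη_mono : ∀ t : ℕ, 1 ≤ t → (t : ℝ) * η t ≤ ((t : ℝ) + 1) * η (t + 1))
    (hηdiff : Tendsto (fun t : ℕ => (η t - η (t + 1)) / η t ^ 2) atTop (nhds 0)) :
    Tendsto (fun t : ℕ => (η t - η (t + 1)) / η (t + 1) ^ 2) atTop (nhds 0) := by
  have h4 : Tendsto (fun t : ℕ => 4 * ((η t - η (t + 1)) / η t ^ 2)) atTop (nhds 0) := by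
    simpa using hηdiff.const_mul 4
  refine squeeze_zero' ?_ ?_ h4
  · filter_upwards [eventually_ge_atTop 1] with t ht
    exact div_nonneg (sub_nonneg.2 (hηmono t ht)) (sq_nonneg _)
  · filter_upwards [eventually_ge_atTop 1] with t ht
    have h1 := hηpos t ht
    have h2 := hηpos (t + 1) (by omega)
    have h3 := le_two_mul_succ hηpos htη_mono ht
    have h5 : 0 ≤ η t - η (t + 1) := sub_nonneg.2 (hηmono t ht)
    rw [← mul_div_assoc, div_le_div_iff₀ (by positivity) (by positivity)]
    have h6 : η t ^ 2 ≤ 4 * η (t + 1) ^ 2 := by nlinarith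
    nlinarith [mul_le_mul_of_nonneg_left h6 h5]

/-- A contractive backward recursion with step sizes `η` and errors `δ` bounds the sum of its
solution. -/
theorem sum_Ioc_le_of_backward_recursion {c : ℝ} {d δ : ℕ → ℝ} {m n : ℕ} (hm : 1 ≤ m)
    (hmn : m ≤ n) (hηpos : ∀ t, 1 ≤ t → 0 < η t) (hηmono : ∀ t, 1 ≤ t → η (t + 1) ≤ η t)
    (hd : ∀ j, 0 ≤ d j)
    (hrec : ∀ j, m ≤ j → j < n → d j ≤ (1 - c * η (j + 1)) * d (j + 1) + η (j + 1) * δ j) :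
    c * ∑ j ∈ Finset.Ioc m n, d j ≤ d n / η n + ∑ j ∈ Finset.Ico m n, δ j := by
  suffices h : ∀ k, m ≤ k → k ≤ n →
      c * ∑ j ∈ Finset.Ioc m k, d j ≤ d k / η k + ∑ j ∈ Finset.Ico m k, δ j from h n hmn le_rfl
  intro k hmk
  induction k, hmk using Nat.le_induction with
  | base => intro _; simpa using div_nonneg (hd m) (hηpos m hm).le
  | succ k hmk ih =>
    intro hk
    have ih := ih (by omega)
    rw [Finset.sum_Ioc_succ_top hmk, Finset.sum_Ico_succ_top hmk, mul_add]
    have h1 := hηpos k (by omega)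
    have h2 := hηpos (k + 1) (by omega)
    have h3 : d k / η k ≤ d k / η (k + 1) :=
      div_le_div_of_nonneg_left (hd k) h2 (hηmono k (by omega))
    have h4 : d k / η (k + 1) ≤ d (k + 1) / η (k + 1) - c * d (k + 1) + δ k := by
      rw [div_le_iff₀ h2]
      have := hrec k hmk (by omega)
      have h5 : (d (k + 1) / η (k + 1) - c * d (k + 1) + δ k) * η (k + 1) =
        d (k + 1) - c * d (k + 1) * η (k + 1) + δ k * η (k + 1) := by field_simp
      rw [h5]
      linarith
    linarith

end StepSizes

section AveragedProducts

variable {R : Type*} [NormedRing R] [NormedAlgebra ℝ R]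

/-- A uniform bound on `A j n` for large `j` extends to all `j ≥ 1`. -/
theorem exists_bound_of_bound_large {G : R} {η : ℕ → ℝ} {A : ℕ → ℕ → R}
    (hdiag : ∀ n, 1 ≤ n → A n n = η n • (1 : R))
    (hrec : ∀ j n, 1 ≤ j → j < n →
      A j n = η j • (1 : R) + (η j / η (j + 1)) • ((1 - η (j + 1) • G) * A (j + 1) n))
    {m : ℕ} (hm : 1 ≤ m) (h : ∃ C, ∀ j n, m ≤ j → j ≤ n → ‖A j n‖ ≤ C) :
    ∃ C, ∀ j n, 1 ≤ j → j ≤ n → ‖A j n‖ ≤ C := by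
  induction m, hm using Nat.le_induction with
  | base => exact h
  | succ m hm ih =>
    obtain ⟨C, hC⟩ := h
    refine ih ⟨max C (‖η m • (1 : R)‖ + ‖η m / η (m + 1)‖ * (‖1 - η (m + 1) • G‖ * |C|)),
      fun j n hj hjn => ?_⟩
    rcases hj.lt_or_eq with hlt | rfl
    · exact (hC j n hlt hjn).trans (le_max_left _ _)
    · refine le_trans ?_ (le_max_right _ _)
      rcases hjn.lt_or_eq with hlt | rfl
      · rw [hrec m n hm hlt]
        refine (norm_add_le _ _).trans ?_
        gcongr
        refine (norm_smul_le _ _).trans ?_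
        gcongr
        refine (norm_mul_le _ _).trans ?_
        gcongr
        exact (hC _ _ le_rfl hlt).trans (le_abs_self C)
      · rw [hdiag m hm]
        exact le_add_of_nonneg_right (by positivity)

/-- Solutions of the backward recursion satisfied by the averaged products are uniformly bounded,
and their distances to the right inverse of `G` tend to zero in Cesàro mean. -/
theorem bounded_and_cesaro_tendsto_of_recursion {G Ginv : R} (hGinv : G * Ginv = 1)
    {h K ρ : ℝ} (hh : 0 < h) (hρ0 : 0 < ρ) (hρ1 : ρ < 1)
    (hK : ∀ k : ℕ, ‖(1 - h • G) ^ k‖ ≤ K * ρ ^ k) {η : ℕ → ℝ}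
    (hηpos : ∀ t, 1 ≤ t → 0 < η t)
    (hηmono : ∀ t, 1 ≤ t → η (t + 1) ≤ η t)
    (hη0 : Tendsto η atTop (nhds 0))
    (htη_mono : ∀ t : ℕ, 1 ≤ t → (t : ℝ) * η t ≤ ((t : ℝ) + 1) * η (t + 1))
    (htη_top : Tendsto (fun t : ℕ => (t : ℝ) * η t) atTop atTop)
    (hηdiff : Tendsto (fun t : ℕ => (η t - η (t + 1)) / η t ^ 2) atTop (nhds 0))
    {A : ℕ → ℕ → R} (hdiag : ∀ n, 1 ≤ n → A n n = η n • (1 : R))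
    (hrec : ∀ j n, 1 ≤ j → j < n →
      A j n = η j • (1 : R) + (η j / η (j + 1)) • ((1 - η (j + 1) • G) * A (j + 1) n)) :
    (∃ C, ∀ j n, 1 ≤ j → j ≤ n → ‖A j n‖ ≤ C) ∧
    Tendsto (fun n : ℕ => (1 / (n : ℝ)) * ∑ j ∈ Finset.Icc 1 n, ‖A j n - Ginv‖)
      atTop (nhds 0) := by
  obtain ⟨N, c, hc, hleN, hNle, hadd, hsmul, hcontr⟩ := exists_contracting_gauge G hh hρ0 hρ1 hK
  have hN0 : ∀ x, 0 ≤ N x := fun x => (norm_nonneg x).trans (hleN x)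
  have hK0 : 0 ≤ K := by simpa using (norm_nonneg _).trans (hK 0)
  have hε := tendsto_sub_div_succ_sq hηpos hηmono htη_mono hηdiff
  set ε : ℕ → ℝ := fun t => (η t - η (t + 1)) / η (t + 1) ^ 2 with hεdef
  have hεeq : ∀ j, 1 ≤ j → η j - η (j + 1) = ε j * η (j + 1) ^ 2 := fun j hj => by
    have := (hηpos (j + 1) (by omega)).ne'
    simp only [hεdef]
    field_simp
  have hratio : ∀ j, 1 ≤ j → η j / η (j + 1) = 1 + ε j * η (j + 1) := fun j hj => by
    have h1 := (hηpos (j + 1) (by omega)).ne'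
    rw [div_eq_iff h1]
    linear_combination hεeq j hj
  have hε0 : ∀ j, 1 ≤ j → 0 ≤ ε j := fun j hj =>
    div_nonneg (sub_nonneg.2 (hηmono j hj)) (sq_nonneg _)
  obtain ⟨m, hm1, hmη, hmc, hmε⟩ : ∃ m, 1 ≤ m ∧ (∀ j, m ≤ j → η j ≤ h) ∧
      (∀ j, m ≤ j → η j ≤ 1 / c) ∧ ∀ j, m ≤ j → ε j ≤ c / 2 := by
    have := ((eventually_ge_atTop 1).and ((hη0.eventually_le_const hh).and
      ((hη0.eventually_le_const (one_div_pos.2 hc)).and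
        (hε.eventually_le_const (half_pos hc)))))
    obtain ⟨m, hm⟩ := eventually_atTop.1 this
    exact ⟨m, (hm m le_rfl).1, fun j hj => (hm j hj).2.1, fun j hj => (hm j hj).2.2.1,
      fun j hj => (hm j hj).2.2.2⟩
  have hcontr' : ∀ j x, m ≤ j →
      N ((1 - η (j + 1) • G) * x) ≤ (1 - c * η (j + 1)) * N x := fun j x hj =>
    hcontr _ x (hηpos _ (by omega)).le (hmη _ (by omega))
  have hη1 : ∀ j, 1 ≤ j → η j ≤ η 1 := fun j hj => le_of_le_of_succ_le hηmono le_rfl hj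
  have hη10 : 0 < η 1 := hηpos 1 le_rfl
  set CA : ℝ := (4 / c + η 1) * N 1 with hCA
  have hCA0 : 0 ≤ CA := mul_nonneg (by positivity) (hN0 1)
  have hNA : ∀ n j, m ≤ j → j ≤ n → N (A j n) ≤ CA := by
    intro n j hj hjn
    induction hjn using Nat.decreasingInduction with
    | self =>
      rw [hdiag n (hm1.trans hj)]
      refine (hsmul _ _ (hηpos n (hm1.trans hj)).le).trans ?_
      have h4 : 0 ≤ 4 / c := by positivity
      exact mul_le_mul_of_nonneg_right (by linarith [hη1 n (hm1.trans hj)]) (hN0 1)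
    | of_succ j hjn ih =>
      have hj1 := hm1.trans hj
      have ih := ih (by omega)
      have hp := hηpos j hj1
      have hp' := hηpos (j + 1) (by omega)
      have hbase : N (A j n) ≤ η j * N 1 + η j / η (j + 1) *
          ((1 - c * η (j + 1)) * N (A (j + 1) n)) := by
        rw [hrec j n hj1 hjn]
        refine (hadd _ _).trans (add_le_add (hsmul _ _ hp.le) ((hsmul _ _ (by positivity)).trans ?_))
        gcongr
        exact hcontr' j _ hj
      have h1 : η j * N 1 ≤ 2 * η (j + 1) * N 1 :=
        mul_le_mul_of_nonneg_right (le_two_mul_succ hηpos htη_mono hj1) (hN0 1)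
      have hfac : η j / η (j + 1) * (1 - c * η (j + 1)) ≤ 1 - c / 2 * η (j + 1) := by
        rw [hratio j hj1]
        have := mul_nonneg (sub_nonneg.2 (hmε j hj)) hp'.le
        have := mul_nonneg (hε0 j hj1) (mul_nonneg hc.le (sq_nonneg (η (j + 1))))
        nlinarith
      have hfac0 : 0 ≤ 1 - c / 2 * η (j + 1) := by
        have := (le_div_iff₀ hc).1 (hmc (j + 1) (by omega))
        have := mul_pos hc hp'
        linarith
      have h2 : η j / η (j + 1) * ((1 - c * η (j + 1)) * N (A (j + 1) n)) ≤
          (1 - c / 2 * η (j + 1)) * CA := by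
        rw [← mul_assoc]
        exact (mul_le_mul_of_nonneg_right hfac (hN0 _)).trans
          (mul_le_mul_of_nonneg_left ih hfac0)
      have h3 : 4 / c * N 1 ≤ CA :=
        mul_le_mul_of_nonneg_right (by linarith) (hN0 1)
      have h5 : 2 * η (j + 1) * N 1 = c / 2 * η (j + 1) * (4 / c * N 1) := by
        field_simp
        ring
      have h6 := mul_le_mul_of_nonneg_left h3 (by positivity : 0 ≤ c / 2 * η (j + 1))
      linarith
  have hbound : ∃ C, ∀ j n, 1 ≤ j → j ≤ n → ‖A j n‖ ≤ C :=
    exists_bound_of_bound_large hdiag hrec hm1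
      ⟨CA, fun j n hj hjn => (hleN _).trans (hNA n j hj hjn)⟩
  refine ⟨hbound, ?_⟩
  obtain ⟨C, hC⟩ := hbound
  set C' : ℝ := C + ‖Ginv‖ with hC'
  have hD : ∀ j n, 1 ≤ j → j ≤ n → ‖A j n - Ginv‖ ≤ C' := fun j n hj hjn =>
    (norm_sub_le _ _).trans (by linarith [hC j n hj hjn])
  have hC'0 : 0 ≤ C' := (norm_nonneg _).trans (hD 1 1 le_rfl le_rfl)
  set L : ℝ := CA + η 1 * N 1 with hL
  have hDrec : ∀ n j, m ≤ j → j < n → N (A j n - Ginv) ≤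
      (1 - c * η (j + 1)) * N (A (j + 1) n - Ginv) + η (j + 1) * (L * |ε j|) := by
    intro n j hj hjn
    have hj1 := hm1.trans hj
    have hp' := hηpos (j + 1) (by omega)
    have he := hε0 j hj1
    have hdecomp : A j n - Ginv = (1 - η (j + 1) • G) * (A (j + 1) n - Ginv) +
        ((ε j * η (j + 1)) • ((1 - η (j + 1) • G) * A (j + 1) n) +
          (ε j * η (j + 1) ^ 2) • (1 : R)) := by
      rw [hrec j n hj1 hjn, hratio j hj1, ← hεeq j hj1, mul_sub _ (A (j + 1) n), sub_mul 1 _ Ginv,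
        smul_mul_assoc, hGinv, add_smul, one_smul, sub_smul, one_mul]
      abel
    have h1 : N ((ε j * η (j + 1)) • ((1 - η (j + 1) • G) * A (j + 1) n)) ≤
        ε j * η (j + 1) * CA := by
      refine (hsmul _ _ (by positivity)).trans ?_
      gcongr
      refine (hcontr' j _ hj).trans ?_
      have h2 : (1 - c * η (j + 1)) * N (A (j + 1) n) ≤ 1 * N (A (j + 1) n) :=
        mul_le_mul_of_nonneg_right (by linarith [mul_pos hc hp']) (hN0 _)
      linarith [hNA n (j + 1) (by omega) hjn]
    have h3 : N ((ε j * η (j + 1) ^ 2) • (1 : R)) ≤ ε j * η (j + 1) * (η 1 * N 1) := by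
      refine (hsmul _ _ (by positivity)).trans ?_
      have := mul_le_mul_of_nonneg_left (mul_le_mul_of_nonneg_right (hη1 (j + 1) (by omega))
        (hN0 1)) (by positivity : 0 ≤ ε j * η (j + 1))
      linarith
    rw [abs_of_nonneg he]
    calc N (A j n - Ginv) ≤ _ := by
          rw [hdecomp]
          exact (hadd _ _).trans (add_le_add_right (hadd _ _) _)
      _ ≤ (1 - c * η (j + 1)) * N (A (j + 1) n - Ginv) +
          (ε j * η (j + 1) * CA + ε j * η (j + 1) * (η 1 * N 1)) :=
        add_le_add (hcontr' j _ hj) (add_le_add h1 h3)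
      _ = _ := by rw [hL]; ring
  have hL0 : 0 ≤ L := add_nonneg hCA0 (mul_nonneg hη10.le (hN0 1))
  have hsum : ∀ n, m ≤ n → ∑ j ∈ Finset.Icc 1 n, ‖A j n - Ginv‖ ≤
      m * C' + 1 / c * (K * C' / η n + ∑ j ∈ Finset.range n, L * |ε j|) := by
    intro n hmn
    have hsplit : Finset.Icc 1 n = Finset.Icc 1 m ∪ Finset.Ioc m n := by
      ext j
      simp only [Finset.mem_Icc, Finset.mem_union, Finset.mem_Ioc]
      omega
    have hdisj : Disjoint (Finset.Icc 1 m) (Finset.Ioc m n) := by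
      rw [Finset.disjoint_left]
      intro j
      simp only [Finset.mem_Icc, Finset.mem_Ioc]
      omega
    rw [hsplit, Finset.sum_union hdisj]
    refine add_le_add ?_ ?_
    · refine (Finset.sum_le_card_nsmul _ _ C' fun j hj => ?_).trans (by simp)
      rw [Finset.mem_Icc] at hj
      exact hD j n hj.1 (hj.2.trans hmn)
    · have h1 := sum_Ioc_le_of_backward_recursion (d := fun j => N (A j n - Ginv))
        hm1 hmn hηpos hηmono (fun j => hN0 _) (hDrec n)
      have hp := hηpos n (hm1.trans hmn)
      have h2 : N (A n n - Ginv) / η n ≤ K * C' / η n := by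
        gcongr
        refine (hNle _).trans ?_
        gcongr
        exact hD n n (hm1.trans hmn) le_rfl
      have h3 : ∑ j ∈ Finset.Ico m n, L * |ε j| ≤ ∑ j ∈ Finset.range n, L * |ε j| := by
        refine Finset.sum_le_sum_of_subset_of_nonneg (fun j hj => ?_) fun j _ _ => by positivity
        exact Finset.mem_range.2 (Finset.mem_Ico.1 hj).2
      have h4 : ∑ j ∈ Finset.Ioc m n, ‖A j n - Ginv‖ ≤ ∑ j ∈ Finset.Ioc m n, N (A j n - Ginv) :=
        Finset.sum_le_sum fun j _ => hleN _
      refine h4.trans ?_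
      rw [one_div, ← div_eq_inv_mul, le_div_iff₀ hc]
      linarith
  have hlim : Tendsto (fun n : ℕ => m * C' * ((n : ℝ))⁻¹ + 1 / c * (K * C' * ((n : ℝ) * η n)⁻¹ +
      (n : ℝ)⁻¹ * ∑ j ∈ Finset.range n, L * |ε j|)) atTop (nhds 0) := by
    have hδ : Tendsto (fun j => L * |ε j|) atTop (nhds 0) := by
      simpa using hε.abs.const_mul L
    have h1 : Tendsto (fun n : ℕ => ((n : ℝ))⁻¹) atTop (nhds 0) :=
      tendsto_inv_atTop_zero.comp tendsto_natCast_atTop_atTop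
    have h2 := tendsto_inv_atTop_zero.comp htη_top
    simpa using (h1.const_mul (m * C')).add
      (((h2.const_mul (K * C')).add hδ.cesaro).const_mul (1 / c))
  refine squeeze_zero' (Eventually.of_forall fun n => by positivity) ?_ hlim
  filter_upwards [eventually_ge_atTop m] with n hmn
  have hn : (0 : ℝ) < n := by exact_mod_cast hm1.trans hmn
  have hp := hηpos n (hm1.trans hmn)
  refine (mul_le_mul_of_nonneg_left (hsum n hmn) (by positivity)).trans (le_of_eq ?_)
  field_simp

end AveragedProducts

section Matrix

open scoped Matrix.Norms.Operator

theorem norm_map_ofReal {d : ℕ} (M : Matrix (Fin d) (Fin d) ℝ) :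
    ‖M.map (Complex.ofReal ·)‖ = ‖M‖ := by
  simp [Matrix.linfty_opNorm_def]

/-- If the spectrum of `G` lies in the open right half plane, then the powers of `1 - h • G` decay
geometrically for some `h > 0`. -/
theorem exists_norm_one_sub_smul_pow_le {d : ℕ} (G : Matrix (Fin d) (Fin d) ℝ)
    (hG : ∀ c ∈ spectrum ℂ (G.map (Complex.ofReal ·)), 0 < c.re) :
    ∃ h K ρ : ℝ, 0 < h ∧ 0 < ρ ∧ ρ < 1 ∧ ∀ k : ℕ, ‖(1 - h • G) ^ k‖ ≤ K * ρ ^ k := by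
  set Gc := G.map (Complex.ofReal ·) with hGc
  have hev : ∀ᶠ h : ℝ in nhdsWithin 0 (Set.Ioi 0),
      ∀ z ∈ spectrum ℂ Gc, ‖1 - (h : ℂ) * z‖ < 1 := by
    refine (eventually_all_finite (Matrix.finite_spectrum Gc)).2 fun z hz => ?_
    have hz0 := hG z hz
    have hpos : 0 < z.re ^ 2 + z.im ^ 2 := by positivity
    have hI : Set.Ioo (0 : ℝ) (z.re / (z.re ^ 2 + z.im ^ 2)) ∈ nhdsWithin 0 (Set.Ioi 0) :=
      Ioo_mem_nhdsGT (by positivity)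
    filter_upwards [hI] with h hh
    have h1 := (lt_div_iff₀ hpos).1 hh.2
    have h2 : ‖1 - (h : ℂ) * z‖ ^ 2 < 1 := by
      rw [← Complex.normSq_eq_norm_sq, Complex.normSq_apply]
      simp
      nlinarith [hh.1, mul_lt_mul_of_pos_left h1 hh.1, mul_pos hh.1 hz0]
    exact (sq_lt_one_iff₀ (norm_nonneg _)).1 h2
  obtain ⟨h, hh, hpos⟩ := (hev.and self_mem_nhdsWithin).exists
  have hpos : 0 < h := hpos
  have hspec : ∀ z ∈ spectrum ℂ (1 - (h : ℂ) • Gc), ‖z‖ < 1 := by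
    intro z hz
    have hu : (h : ℂ) ≠ 0 := by exact_mod_cast hpos.ne'
    have h1 : (1 : Matrix (Fin d) (Fin d) ℂ) - (h : ℂ) • Gc =
        algebraMap ℂ _ 1 - (Units.mk0 (h : ℂ) hu) • Gc := by simp [Units.smul_def]
    rw [h1, ← spectrum.singleton_sub_eq, spectrum.unit_smul_eq_smul] at hz
    obtain ⟨_, rfl, _, ⟨w, hw, rfl⟩, rfl⟩ := hz
    simpa [Units.smul_def] using hh w hw
  obtain ⟨K, ρ, hρ0, hρ1, hK⟩ := exists_norm_pow_le_of_spectrum_lt_one _ hspec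
  refine ⟨h, K, ρ, hpos, hρ0, hρ1, fun k => ?_⟩
  have hmap : (1 - (h : ℂ) • Gc) ^ k = ((1 - h • G) ^ k).map (Complex.ofReal ·) := by
    have h2 : (1 - (h : ℂ) • Gc) = Complex.ofRealHom.mapMatrix (1 - h • G) := by
      ext i j
      by_cases hij : i = j <;> simp [hGc, hij]
    rw [h2, ← map_pow]
    rfl
  rw [← norm_map_ofReal, ← hmap]
  exact hK k

theorem isUnit_of_spectrum_re_pos {d : ℕ} (G : Matrix (Fin d) (Fin d) ℝ)
    (hG : ∀ c ∈ spectrum ℂ (G.map (Complex.ofReal ·)), 0 < c.re) : IsUnit G := by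
  have h0 : (0 : ℂ) ∉ spectrum ℂ (G.map (Complex.ofReal ·)) := fun h => by simpa using hG 0 h
  have h1 := (Matrix.isUnit_iff_isUnit_det _).1 ((spectrum.zero_notMem_iff ℂ).1 h0)
  have h2 : (G.map (Complex.ofReal ·)).det = (G.det : ℂ) :=
    (Complex.ofRealHom.map_det G).symm
  rw [h2, isUnit_iff_ne_zero] at h1
  rw [Matrix.isUnit_iff_isUnit_det, isUnit_iff_ne_zero]
  exact_mod_cast h1

theorem exists_matOpNorm_le (d : ℕ) :
    ∃ C > (0 : ℝ), ∀ M : Matrix (Fin d) (Fin d) ℝ, matOpNorm M ≤ C * ‖M‖ := by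
  let f : Matrix (Fin d) (Fin d) ℝ →ₗ[ℝ]
      (EuclideanSpace ℝ (Fin d) →L[ℝ] EuclideanSpace ℝ (Fin d)) :=
    LinearMap.toContinuousLinearMap.toLinearMap ∘ₗ Matrix.toEuclideanLin.toLinearMap
  obtain ⟨C, hC, h⟩ := (LinearMap.toContinuousLinearMap f).bound
  exact ⟨C, hC, h⟩

theorem sum_smul_prod_recursion {d : ℕ} {G : Matrix (Fin d) (Fin d) ℝ} {η : ℕ → ℝ}
    {j n : ℕ} (hη : η (j + 1) ≠ 0) (hjn : j < n) :
    ∑ t ∈ Finset.Icc j n, η j • (((List.range' (j + 1) (t - j)).map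
        (fun i => (1 : Matrix (Fin d) (Fin d) ℝ) - η i • G)).prod) =
      η j • 1 + (η j / η (j + 1)) • ((1 - η (j + 1) • G) *
        ∑ t ∈ Finset.Icc (j + 1) n, η (j + 1) • (((List.range' (j + 1 + 1) (t - (j + 1))).map
          (fun i => (1 : Matrix (Fin d) (Fin d) ℝ) - η i • G)).prod)) := by
  rw [← Finset.insert_Icc_add_one_left_eq_Icc hjn.le, Finset.sum_insert (by simp), Finset.mul_sum,
    Finset.smul_sum]
  congr 1
  · simp
  · refine Finset.sum_congr rfl fun t ht => ?_
    have ht : t - j = t - (j + 1) + 1 := by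
      have := (Finset.mem_Icc.1 ht).1
      omega
    rw [ht, List.range'_succ, List.map_cons, List.prod_cons, mul_smul_comm, smul_smul,
      div_mul_cancel₀ _ hη]

end Matrix

open scoped Matrix.Norms.Operator in
/-- Polyak–Juditsky-type matrix lemma: `G` is invertible, the
partial-sum matrices `A_j^n = ∑_{t=j}^{n} (∏_{i=j+1}^{t} (I - η_i G)) η_j` are
uniformly bounded in operator norm, and their Cesàro averages converge to
`G⁻¹`. -/
theorem stmt15
    {d : ℕ} (G : Matrix (Fin d) (Fin d) ℝ)
    (hG : ∀ c ∈ spectrum ℂ (G.map (Complex.ofReal ·)), 0 < c.re)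
    (η : ℕ → ℝ)
    (hηpos : ∀ t, 1 ≤ t → 0 < η t)
    (hηmono : ∀ t, 1 ≤ t → η (t + 1) ≤ η t)
    (hη0 : Tendsto η atTop (nhds 0))
    (htη_mono : ∀ t : ℕ, 1 ≤ t → (t : ℝ) * η t ≤ ((t : ℝ) + 1) * η (t + 1))
    (htη_top : Tendsto (fun t : ℕ => (t : ℝ) * η t) atTop atTop)
    (hηdiff : Tendsto (fun t : ℕ => (η t - η (t + 1)) / η t ^ 2) atTop (nhds 0))
    (hηsum : Summable (fun t : ℕ => η t / Real.sqrt t))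
    (A : ℕ → ℕ → Matrix (Fin d) (Fin d) ℝ)
    (hA : ∀ j n, A j n = ∑ t ∈ Finset.Icc j n,
      η j • (((List.range' (j + 1) (t - j)).map
        (fun i => (1 : Matrix (Fin d) (Fin d) ℝ) - η i • G)).prod)) :
    IsUnit G ∧
    (∃ C_A > (0 : ℝ), ∀ j n : ℕ, 1 ≤ j → j ≤ n → matOpNorm (A j n) ≤ C_A) ∧
    Tendsto (fun n : ℕ =>
        (1 / (n : ℝ)) * ∑ j ∈ Finset.Icc 1 n, matOpNorm (A j n - G⁻¹))
      atTop (nhds 0) := by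
  have hunit := isUnit_of_spectrum_re_pos G hG
  obtain ⟨h, K, ρ, hh, hρ0, hρ1, hK⟩ := exists_norm_one_sub_smul_pow_le G hG
  have hGinv : G * G⁻¹ = 1 :=
    Matrix.mul_nonsing_inv G ((Matrix.isUnit_iff_isUnit_det G).1 hunit)
  have hdiag : ∀ n, 1 ≤ n → A n n = η n • 1 := fun n _ => by simp [hA]
  have hrec : ∀ j n, 1 ≤ j → j < n →
      A j n = η j • 1 + (η j / η (j + 1)) • ((1 - η (j + 1) • G) * A (j + 1) n) :=
    fun j n hj hjn => by
      rw [hA, hA, sum_smul_prod_recursion (hηpos (j + 1) (by omega)).ne' hjn]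
  obtain ⟨⟨C, hC⟩, hlim⟩ := bounded_and_cesaro_tendsto_of_recursion hGinv hh hρ0 hρ1 hK hηpos hηmono
    hη0 htη_mono htη_top hηdiff hdiag hrec
  obtain ⟨c, hc, hle⟩ := exists_matOpNorm_le d
  refine ⟨hunit, ⟨c * (|C| + 1), by positivity, fun j n hj hjn => (hle _).trans ?_⟩, ?_⟩
  · exact mul_le_mul_of_nonneg_left (by linarith [hC j n hj hjn, le_abs_self C]) hc.le
  · have hlim' := hlim.const_mul c
    rw [mul_zero] at hlim'
    have hnn : ∀ M : Matrix (Fin d) (Fin d) ℝ, 0 ≤ matOpNorm M := fun M => norm_nonneg _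
    refine squeeze_zero (fun n => mul_nonneg (by positivity) (Finset.sum_nonneg fun j _ => hnn _))
      (fun n => ?_) hlim'
    rw [mul_left_comm c, Finset.mul_sum _ _ c]
    exact mul_le_mul_of_nonneg_left (Finset.sum_le_sum fun j _ => hle _) (by positivity)
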